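/- arXiv:1406.5985 — 3 statements merged into one kernel-verified Lean document; each statement's English description precedes it below -/
import Mathlib

section
/- Let B_h be a bisector and let P = ℙ(T) be an ℝ-plane with P ⊆ B_h. Then P contains the real spine of B_h: for every nonzero v ∈ V with ⟨h v, v⟩ = 0 and h v ≠ 0, the point [h v] belongs to P. -/
open scoped ComplexConjugate

noncomputable section

/-- `V` is `ℂ³`. -/
abbrev V3 : Type := Fin 3 → ℂ

/-- The hermitian form of signature `(2,1)`:
`⟨x,y⟩ = x₀·conj y₀ + x₁·conj y₁ − x₂·conj y₂`. -/
def herm (x y : V3) : ℂ := x 0 * conj (y 0) + x 1 * conj (y 1) - x 2 * conj (y 2)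

/-- The complex projective plane `ℙ(V)`. -/
abbrev PV : Type := Projectivization ℂ V3

/-- The class `[v]` of a nonzero vector `v` in `ℙ(V)`. -/
def projMk (v : V3) (hv : v ≠ 0) : PV := Projectivization.mk ℂ v hv

/-- A map `h` is self-adjoint (`h* = h`) w.r.t. the hermitian form. -/
def SelfAdj (h : Module.End ℂ V3) : Prop := ∀ x y : V3, herm (h x) y = herm x (h y)

/-- The set `B_h = {[v] ∈ ℙ(V) | ⟨h v, v⟩ = 0}`. -/
def Bset (h : Module.End ℂ V3) : Set PV :=
  {q | ∃ v : V3, ∃ hv : v ≠ 0, q = projMk v hv ∧ herm (h v) v = 0}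

/-- `h` defines a bisector: self-adjoint, trace `0`, rank `2`, and `B_h` contains
a point other than the focus (i.e. a point `[v]` with `h v ≠ 0`). -/
def IsBisector (h : Module.End ℂ V3) : Prop :=
  SelfAdj h ∧ LinearMap.trace ℂ V3 h = 0 ∧
    Module.finrank ℂ (LinearMap.range h) = 2 ∧ ∃ v : V3, herm (h v) v = 0 ∧ h v ≠ 0

/-- A linear family of bisectors: an `ℝ`-subspace of self-adjoint traceless
degenerate maps whose base contains a negative point. -/
def IsLinearFamily (W : Submodule ℝ (Module.End ℂ V3)) : Prop :=
  (∀ h ∈ W, SelfAdj h ∧ LinearMap.trace ℂ V3 h = 0 ∧ LinearMap.det h = 0) ∧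
    ∃ v : V3, ∃ hv : v ≠ 0, (herm v v).re < 0 ∧ ∀ h ∈ W, herm (h v) v = 0

/-- The map `x ↦ ⟨x,p⟩·p`. -/
def wmap (p : V3) : Module.End ℂ V3 where
  toFun x := herm x p • p
  map_add' x y := by
    show herm (x + y) p • p = herm x p • p + herm y p • p
    have : herm (x + y) p = herm x p + herm y p := by
      simp only [herm, Pi.add_apply]; ring
    rw [this, add_smul]
  map_smul' c x := by
    show herm (c • x) p • p = c • (herm x p • p)
    have : herm (c • x) p = c * herm x p := by
      simp only [herm, Pi.smul_apply, smul_eq_mul]; ring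
    rw [this, mul_smul]

/-- `ℙ(U)` for a complex subspace `U`. -/
def projC (U : Submodule ℂ V3) : Set PV :=
  {q | ∃ v : V3, ∃ hv : v ≠ 0, v ∈ U ∧ q = projMk v hv}

/-- `ℙ(T)` for a real subspace `T`. -/
def projR (T : Submodule ℝ V3) : Set PV :=
  {q | ∃ v : V3, ∃ hv : v ≠ 0, v ∈ T ∧ q = projMk v hv}

/-- An `ℝ`-plane: `ℙ(T)` for a totally real `3`-dimensional real subspace `T`
with `ℂ·T = V`. -/
def IsRealPlane (T : Submodule ℝ V3) : Prop :=
  Module.finrank ℝ T = 3 ∧ Submodule.span ℂ (T : Set V3) = ⊤ ∧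
    ∀ t ∈ T, ∀ t' ∈ T, (herm t t').im = 0

/-- A geodesic: `ℙ(W₀)` for a `2`-dimensional real subspace `W₀` on which the form
is real-valued and not identically zero. -/
def IsGeodesic (W₀ : Submodule ℝ V3) : Prop :=
  Module.finrank ℝ W₀ = 2 ∧ (∀ w ∈ W₀, ∀ w' ∈ W₀, (herm w w').im = 0) ∧
    ∃ w ∈ W₀, ∃ w' ∈ W₀, herm w w' ≠ 0

/-- The real spine `R = {[h v] | [v] ∈ B_h, h v ≠ 0}` of `B_h`. -/
def RealSpine (h : Module.End ℂ V3) : Set PV :=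
  {q | ∃ v : V3, ∃ hnz : h v ≠ 0, herm (h v) v = 0 ∧ q = projMk (h v) hnz}

/-- The orthogonal complement w.r.t. the hermitian form. -/
def hermOrth (U : Submodule ℂ V3) : Submodule ℂ V3 where
  carrier := {x | ∀ u ∈ U, herm x u = 0}
  add_mem' := by
    intro a b ha hb u hu
    have h1 : herm (a + b) u = herm a u + herm b u := by
      simp only [herm, Pi.add_apply]; ring
    rw [h1, ha u hu, hb u hu, add_zero]
  zero_mem' := by
    intro u hu
    simp [herm]
  smul_mem' := by
    intro c x hx u hu
    have h1 : herm (c • x) u = c * herm x u := by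
      simp only [herm, Pi.smul_apply, smul_eq_mul]; ring
    rw [h1, hx u hu, mul_zero]


theorem herm_add_left (x y z : V3) : herm (x + y) z = herm x z + herm y z := by
  simp only [herm, Pi.add_apply]; ring

theorem herm_add_right (x y z : V3) : herm x (y + z) = herm x y + herm x z := by
  simp only [herm, Pi.add_apply, map_add]; ring

theorem herm_smul_left (c : ℂ) (x y : V3) : herm (c • x) y = c * herm x y := by
  simp only [herm, Pi.smul_apply, smul_eq_mul]; ring

theorem herm_smul_right (c : ℂ) (x y : V3) : herm x (c • y) = conj c * herm x y := by
  simp only [herm, Pi.smul_apply, smul_eq_mul, map_mul]; ring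

theorem conj_herm (x y : V3) : conj (herm x y) = herm y x := by
  simp only [herm, map_add, map_sub, map_mul, Complex.conj_conj]; ring

/-- The hermitian form is nondegenerate, and this can be tested on a spanning set. -/
theorem eq_zero_of_herm_eq_zero {S : Set V3} (hS : Submodule.span ℂ S = ⊤) {u : V3}
    (hu : ∀ t ∈ S, herm u t = 0) : u = 0 := by
  have key (w : V3) : herm u w = 0 := by
    have hw : w ∈ Submodule.span ℂ S := hS ▸ Submodule.mem_top
    induction hw using Submodule.span_induction with
    | mem x hx => exact hu x hx
    | zero => simp [herm]
    | add x y _ _ hx hy => rw [herm_add_right, hx, hy, add_zero]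
    | smul c x _ hx => rw [herm_smul_right, hx, mul_zero]
  funext i
  have hi := key (Pi.single i 1)
  fin_cases i <;> simpa [herm] using hi

/-- A complex spanning real subspace `T` satisfies `V = T + iT`. -/
theorem exists_eq_add_I_smul {T : Submodule ℝ V3}
    (hT : Submodule.span ℂ (T : Set V3) = ⊤) (v : V3) :
    ∃ x ∈ T, ∃ y ∈ T, v = x + Complex.I • y := by
  have hv : v ∈ Submodule.span ℂ (T : Set V3) := hT ▸ Submodule.mem_top
  induction hv using Submodule.span_induction with
  | mem x hx => exact ⟨x, hx, 0, T.zero_mem, by simp⟩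
  | zero => exact ⟨0, T.zero_mem, 0, T.zero_mem, by simp⟩
  | add v w _ _ hv hw =>
    obtain ⟨x, hx, y, hy, rfl⟩ := hv
    obtain ⟨x', hx', y', hy', rfl⟩ := hw
    exact ⟨x + x', T.add_mem hx hx', y + y', T.add_mem hy hy', by rw [smul_add]; abel⟩
  | smul c v _ hv =>
    obtain ⟨x, hx, y, hy, rfl⟩ := hv
    refine ⟨c.re • x - c.im • y, T.sub_mem (T.smul_mem _ hx) (T.smul_mem _ hy),
      c.im • x + c.re • y, T.add_mem (T.smul_mem _ hx) (T.smul_mem _ hy), ?_⟩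
    funext i
    apply Complex.ext <;> simp <;> ring

theorem IsRealPlane.eq_zero_of_add_I_smul_eq_zero {T : Submodule ℝ V3} (hT : IsRealPlane T)
    {x y : V3} (hx : x ∈ T) (hy : y ∈ T) (hxy : x + Complex.I • y = 0) : x = 0 ∧ y = 0 := by
  have hy0 : y = 0 := by
    refine eq_zero_of_herm_eq_zero hT.2.1 fun t ht => ?_
    have h0 : herm (x + Complex.I • y) t = 0 := by rw [hxy]; simp [herm]
    rw [herm_add_left, herm_smul_left] at h0
    have him := congrArg Complex.im h0
    simp [hT.2.2 x hx t ht] at him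
    exact Complex.ext him (hT.2.2 y hy t ht)
  subst hy0
  exact ⟨by simpa using hxy, rfl⟩

/-- A vector whose products with all elements of a real plane `T` are real lies in `T`. -/
theorem IsRealPlane.mem_of_herm_im_eq_zero {T : Submodule ℝ V3} (hT : IsRealPlane T)
    {u : V3} (hu : ∀ t ∈ T, (herm u t).im = 0) : u ∈ T := by
  obtain ⟨p, hp, q, hq, rfl⟩ := exists_eq_add_I_smul hT.2.1 u
  have hq0 : q = 0 := by
    refine eq_zero_of_herm_eq_zero hT.2.1 fun t ht => ?_
    have h0 := hu t ht
    rw [herm_add_left, herm_smul_left] at h0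
    simp [hT.2.2 p hp t ht] at h0
    exact Complex.ext h0 (hT.2.2 q hq t ht)
  simpa [hq0] using hp

theorem herm_apply_self_of_projR_subset {h : Module.End ℂ V3} {T : Submodule ℝ V3}
    (hsub : projR T ⊆ Bset h) {t : V3} (ht : t ∈ T) : herm (h t) t = 0 := by
  by_cases ht0 : t = 0
  · simp [ht0, herm]
  obtain ⟨v, hv, hq, hz⟩ := hsub ⟨t, ht0, ht, rfl⟩
  obtain ⟨a, rfl⟩ := (Projectivization.mk_eq_mk_iff' ℂ t v ht0 hv).1 hq
  rw [map_smul, herm_smul_left, herm_smul_right, hz, mul_zero, mul_zero]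

/-- If `ℙ(T) ⊆ B_h` then `ih` preserves `T`. -/
theorem IsRealPlane.I_smul_apply_mem {h : Module.End ℂ V3} (hs : SelfAdj h)
    {T : Submodule ℝ V3} (hT : IsRealPlane T) (hsub : projR T ⊆ Bset h) {s : V3} (hsT : s ∈ T) :
    Complex.I • h s ∈ T := by
  refine hT.mem_of_herm_im_eq_zero fun t ht => ?_
  have h0 := herm_apply_self_of_projR_subset hsub (T.add_mem hsT ht)
  rw [map_add, herm_add_left, herm_add_right, herm_add_right,
    herm_apply_self_of_projR_subset hsub hsT, herm_apply_self_of_projR_subset hsub ht,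
    hs t s, ← conj_herm (h s) t] at h0
  have hre := congrArg Complex.re h0
  simp at hre
  rw [herm_smul_left]
  simp
  linarith

/-- `h` has a kernel vector inside `T`. -/
theorem IsRealPlane.exists_mem_ker {h : Module.End ℂ V3} (hs : SelfAdj h)
    (hr : Module.finrank ℂ (LinearMap.range h) = 2)
    {T : Submodule ℝ V3} (hT : IsRealPlane T) (hsub : projR T ⊆ Bset h) :
    ∃ f ∈ T, f ≠ 0 ∧ h f = 0 := by
  have hker : LinearMap.ker h ≠ ⊥ := by
    intro hk
    have := LinearMap.finrank_range_add_finrank_ker h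
    rw [hr, hk] at this
    simp at this
  obtain ⟨g, hg, hg0⟩ := Submodule.exists_mem_ne_zero_of_ne_bot hker
  obtain ⟨p, hp, q, hq, rfl⟩ := exists_eq_add_I_smul hT.2.1 g
  have hsum : Complex.I • h p + Complex.I • (Complex.I • h q) = 0 := by
    have : h p + Complex.I • h q = 0 := by simpa using hg
    rw [← smul_add, this, smul_zero]
  obtain ⟨hp0, hq0⟩ := hT.eq_zero_of_add_I_smul_eq_zero
    (hT.I_smul_apply_mem hs hsub hp) (hT.I_smul_apply_mem hs hsub hq) hsum
  have hp0 : h p = 0 := by simpa using hp0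
  have hq0 : h q = 0 := by simpa using hq0
  by_cases hpz : p = 0
  · exact ⟨q, hq, fun hqz => hg0 (by simp [hpz, hqz]), hq0⟩
  · exact ⟨p, hp, hpz, hp0⟩

/-- If `ℙ(T) ⊆ B_h` and `[x + iy] ∈ B_h` with `x, y ∈ T`, then `h x` and `h y` are linearly
dependent over `ℝ`. -/
theorem IsRealPlane.not_linearIndependent {h : Module.End ℂ V3} (hs : SelfAdj h)
    (hr : Module.finrank ℂ (LinearMap.range h) = 2)
    {T : Submodule ℝ V3} (hT : IsRealPlane T) (hsub : projR T ⊆ Bset h)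
    {x y : V3} (hx : x ∈ T) (hy : y ∈ T)
    (hv : herm (h (x + Complex.I • y)) (x + Complex.I • y) = 0) :
    ¬ LinearIndependent ℝ ![h x, h y] := by
  intro hli
  obtain ⟨f, hf, hf0, hfk⟩ := hT.exists_mem_ker hs hr hsub
  have hyx : herm (h y) x = 0 := by
    have hre : (herm (h y) x).re = 0 := by
      have him := hT.2.2 _ (hT.I_smul_apply_mem hs hsub hy) x hx
      rw [herm_smul_left] at him
      simpa using him
    have hxx := herm_apply_self_of_projR_subset hsub hx
    have hyy := herm_apply_self_of_projR_subset hsub hy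
    rw [map_add, map_smul, herm_add_left, herm_add_right, herm_add_right, herm_smul_left,
      herm_smul_left, herm_smul_right, herm_smul_right, hxx, hyy, hs x y,
      ← conj_herm (h y) x] at hv
    have him := congrArg Complex.re hv
    simp at him
    exact Complex.ext hre (by simp; linarith)
  have hli3 : LinearIndependent ℝ ![(⟨x, hx⟩ : T), ⟨y, hy⟩, ⟨f, hf⟩] := by
    rw [LinearIndependent.pair_iff] at hli
    rw [Fintype.linearIndependent_iff]
    intro g hg
    have hg' : g 0 • x + g 1 • y + g 2 • f = 0 := by
      simpa [Fin.sum_univ_three] using congrArg Subtype.val hg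
    have hgh := congrArg h hg'
    rw [map_add, map_add, LinearMap.map_smul_of_tower, LinearMap.map_smul_of_tower,
      LinearMap.map_smul_of_tower, hfk, smul_zero, add_zero, map_zero] at hgh
    obtain ⟨h0, h1⟩ := hli _ _ hgh
    have h2 : g 2 = 0 := by simpa [h0, h1, hf0] using hg'
    intro i
    fin_cases i <;> assumption
  have hspan := hli3.span_eq_top_of_card_eq_finrank (by simp [hT.1])
  have hhy : h y = 0 := by
    refine eq_zero_of_herm_eq_zero hT.2.1 fun t ht => ?_
    have htm : (⟨t, ht⟩ : T) ∈ Submodule.span ℝ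
        (Set.range ![(⟨x, hx⟩ : T), ⟨y, hy⟩, ⟨f, hf⟩]) := hspan ▸ Submodule.mem_top
    obtain ⟨c, hc⟩ := (Submodule.mem_span_range_iff_exists_fun ℝ).1 htm
    have hc' : (c 0 : ℂ) • x + (c 1 : ℂ) • y + (c 2 : ℂ) • f = t := by
      simpa [Fin.sum_univ_three] using congrArg Subtype.val hc
    rw [← hc', herm_add_right, herm_add_right, herm_smul_right, herm_smul_right,
      herm_smul_right, hyx, herm_apply_self_of_projR_subset hsub hy, hs y f, hfk]
    simp [herm]
  exact hli.ne_zero 1 (by simpa using hhy)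

/-- from Corollary 2.10: an `ℝ`-plane contained in a bisector contains
its real spine. -/
theorem stmt_13 (h : Module.End ℂ V3) (hb : IsBisector h)
    (T : Submodule ℝ V3) (hT : IsRealPlane T) (hsub : projR T ⊆ Bset h) :
    ∀ v : V3, v ≠ 0 → herm (h v) v = 0 → ∀ hnz : h v ≠ 0,
      projMk (h v) hnz ∈ projR T := by
  intro v _ hv hnz
  obtain ⟨hs, -, hr, -⟩ := hb
  obtain ⟨x, hx, y, hy, rfl⟩ := exists_eq_add_I_smul hT.2.1 v
  have hdep := hT.not_linearIndependent hs hr hsub hx hy hv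
  rw [LinearIndependent.pair_iff] at hdep
  push Not at hdep
  obtain ⟨a, b, hab, hne⟩ := hdep
  set c : ℂ := (b + Complex.I * a) * Complex.I with hc
  have hc0 : c ≠ 0 := by
    intro h0
    have hre := congrArg Complex.re h0
    have him := congrArg Complex.im h0
    simp [hc] at hre him
    exact hne hre him
  have hw : c • h (x + Complex.I • y) = b • (Complex.I • h x) - a • (Complex.I • h y) := by
    have hab' : (a : ℂ) • h x + (b : ℂ) • h y = 0 := by simpa using hab
    funext i
    have hi := congrFun hab' i
    simp only [Pi.add_apply, Pi.smul_apply, smul_eq_mul, Pi.zero_apply] at hi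
    simp only [hc, map_add, map_smul, Pi.add_apply, Pi.sub_apply, Pi.smul_apply, smul_eq_mul,
      Complex.real_smul]
    linear_combination (Complex.I ^ 2) * hi + (Complex.I * a * h y i) * Complex.I_sq
  refine ⟨c • h (x + Complex.I • y), smul_ne_zero hc0 hnz, ?_, ?_⟩
  · rw [hw]
    exact T.sub_mem (T.smul_mem _ (hT.I_smul_apply_mem hs hsub hx))
      (T.smul_mem _ (hT.I_smul_apply_mem hs hsub hy))
  · refine (Projectivization.mk_eq_mk_iff' ℂ _ _ _ _).2 ⟨c⁻¹, ?_⟩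
    rw [smul_smul, inv_mul_cancel₀ hc0, one_smul]

end
end

section
/- Let 𝕂 be a field with characteristic different from 2, let W and A be 𝕂-linear spaces with dim_𝕂 W = 2 and dim_𝕂 A = 3, and let N ⊆ W ⊗_𝕂 A be a 𝕂-linear subspace with dim_𝕂 N = 3 such that for every nonzero w ∈ W there exists a nonzero a ∈ A with w ⊗ a ∈ N. Then either there exists a nonzero a ∈ A such that w ⊗ a ∈ N for every w ∈ W, or there exists a 𝕂-linear subspace A' ⊆ A with dim_𝕂 A' ≤ 2 such that N is contained in the image of W ⊗_𝕂 A' in W ⊗_𝕂 A. -/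
open scoped TensorProduct

/-- The coefficients of a tensor with respect to a basis of a two-dimensional left factor
are unique. -/
theorem eq_zero_of_basis_tmul_add_eq_zero {K W A : Type*} [Field K] [AddCommGroup W] [Module K W]
    [AddCommGroup A] [Module K A] (b : Module.Basis (Fin 2) K W) {u v : A}
    (h : b 0 ⊗ₜ[K] u + b 1 ⊗ₜ[K] v = 0) : u = 0 ∧ v = 0 := by
  constructor
  · simpa using congrArg (TensorProduct.lid K A ∘ (b.coord 0).rTensor A) h
  · simpa using congrArg (TensorProduct.lid K A ∘ (b.coord 1).rTensor A) h

/-- If `x • b + z • a = 0` with `z ≠ 0`, then `w ⊗ b ∈ N` implies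
`w ⊗ a ∈ N`. -/
theorem tmul_mem_of_smul_add_smul_eq_zero {K W A : Type*} [Field K] [AddCommGroup W] [Module K W]
    [AddCommGroup A] [Module K A] {N : Submodule K (W ⊗[K] A)} {w : W} {a b : A} {x z : K}
    (hz : z ≠ 0) (h : x • b + z • a = 0) (hb : w ⊗ₜ[K] b ∈ N) : w ⊗ₜ[K] a ∈ N := by
  have ha : a = (-(z⁻¹ * x)) • b := by
    rw [neg_smul, mul_smul, eq_neg_of_add_eq_zero_left h, smul_neg, neg_neg, inv_smul_smul₀ hz]
  rw [ha, TensorProduct.tmul_smul]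
  exact N.smul_mem _ hb

/-- Lemma 3.1. -/
theorem stmt_16 (K : Type*) [Field K] (hchar : ringChar K ≠ 2)
    (W A : Type*) [AddCommGroup W] [Module K W] [AddCommGroup A] [Module K A]
    (hW : Module.finrank K W = 2) (hA : Module.finrank K A = 3)
    (N : Submodule K (W ⊗[K] A)) (hN : Module.finrank K N = 3)
    (hmeet : ∀ w : W, w ≠ 0 → ∃ a : A, a ≠ 0 ∧ w ⊗ₜ[K] a ∈ N) :
    (∃ a : A, a ≠ 0 ∧ ∀ w : W, w ⊗ₜ[K] a ∈ N) ∨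
      (∃ A' : Submodule K A, Module.finrank K A' ≤ 2 ∧
        N ≤ LinearMap.range (TensorProduct.map (LinearMap.id : W →ₗ[K] W) A'.subtype)) := by
  have h2 : (2 : K) ≠ 0 := Ring.two_ne_zero hchar
  have : FiniteDimensional K W := Module.finite_of_finrank_pos (by omega)
  have : FiniteDimensional K A := Module.finite_of_finrank_pos (by omega)
  let b : Module.Basis (Fin 2) K W := Module.finBasisOfFinrankEq K W hW
  have hadd : b 0 + b 1 ≠ 0 := fun h => by
    simpa using congrArg (b.coord 0) h
  have hsub : b 0 - b 1 ≠ 0 := fun h => by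
    simpa using congrArg (b.coord 0) h
  obtain ⟨a₁, ha₁, h₁⟩ := hmeet _ (b.ne_zero 0)
  obtain ⟨a₂, ha₂, h₂⟩ := hmeet _ (b.ne_zero 1)
  obtain ⟨a₃, ha₃, h₃⟩ := hmeet _ hadd
  obtain ⟨a₄, ha₄, h₄⟩ := hmeet _ hsub
  let t : Fin 3 → W ⊗[K] A := ![b 0 ⊗ₜ a₁, b 1 ⊗ₜ a₂, (b 0 + b 1) ⊗ₜ a₃]
  have htN : Submodule.span K (Set.range t) ≤ N := by
    rw [Submodule.span_le]
    rintro _ ⟨i, rfl⟩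
    fin_cases i
    exacts [h₁, h₂, h₃]
  by_cases hli : LinearIndependent K t
  · right
    have hspan : Submodule.span K (Set.range t) = N :=
      Submodule.eq_of_le_of_finrank_eq htN (by rw [finrank_span_eq_card hli, hN]; simp)
    rw [← hspan] at h₄
    obtain ⟨c, hc⟩ := (Submodule.mem_span_range_iff_exists_fun K).1 h₄
    obtain ⟨e₁, e₂⟩ := eq_zero_of_basis_tmul_add_eq_zero b
      (u := c 0 • a₁ + c 2 • a₃ - a₄) (v := c 1 • a₂ + c 2 • a₃ + a₄) (by
        rw [← sub_eq_zero] at hc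
        rw [← hc]
        simp only [t, Fin.sum_univ_three, Matrix.cons_val, TensorProduct.add_tmul,
          TensorProduct.sub_tmul, TensorProduct.tmul_add, TensorProduct.tmul_sub,
          TensorProduct.tmul_smul]
        module)
    let s : Fin 3 → A := ![a₁, a₂, a₃]
    have hs : ¬ LinearIndependent K s := fun h => by
      have hrel := Fintype.linearIndependent_iff.1 h ![c 0, c 1, 2 * c 2] (by
        simp only [s, Fin.sum_univ_three, Matrix.cons_val]
        linear_combination (norm := module) e₁ + e₂)
      have hc₀ : c 0 = 0 := hrel 0
      have hc₂ : c 2 = 0 := (mul_eq_zero.1 (hrel 2)).resolve_left h2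
      simp [hc₀, hc₂, ha₄] at e₁
    refine ⟨Submodule.span K (Set.range s), ?_, ?_⟩
    · rw [linearIndependent_iff_card_le_finrank_span, Set.finrank, Fintype.card_fin] at hs
      omega
    · have hmem (w : W) (i : Fin 3) : w ⊗ₜ[K] s i ∈ LinearMap.range (TensorProduct.map
          (LinearMap.id : W →ₗ[K] W) (Submodule.span K (Set.range s)).subtype) :=
        ⟨w ⊗ₜ ⟨s i, Submodule.subset_span ⟨i, rfl⟩⟩, by simp⟩
      rw [← hspan, Submodule.span_le]
      rintro _ ⟨i, rfl⟩
      fin_cases i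
      exacts [hmem _ 0, hmem _ 1, hmem _ 2]
  · left
    rw [Fintype.linearIndependent_iff] at hli
    push Not at hli
    obtain ⟨c, hc, i, hi⟩ := hli
    obtain ⟨e₁, e₂⟩ := eq_zero_of_basis_tmul_add_eq_zero b
      (u := c 0 • a₁ + c 2 • a₃) (v := c 1 • a₂ + c 2 • a₃) (by
        rw [← hc]
        simp only [t, Fin.sum_univ_three, Matrix.cons_val, TensorProduct.add_tmul,
          TensorProduct.tmul_add, TensorProduct.tmul_smul]
        module)
    have hz : c 2 ≠ 0 := fun hz => by
      have hc₀ : c 0 = 0 := by simpa [hz, ha₁] using e₁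
      have hc₁ : c 1 = 0 := by simpa [hz, ha₂] using e₂
      fin_cases i
      exacts [hi hc₀, hi hc₁, hi hz]
    refine ⟨a₃, ha₃, fun w => ?_⟩
    rw [← b.sum_repr w, Fin.sum_univ_two, TensorProduct.add_tmul, ← TensorProduct.smul_tmul',
      ← TensorProduct.smul_tmul']
    exact N.add_mem (N.smul_mem _ (tmul_mem_of_smul_add_smul_eq_zero hz e₁ h₁))
      (N.smul_mem _ (tmul_mem_of_smul_add_smul_eq_zero hz e₂ h₂))
end

section
/- Let V be a 3-dimensional ℂ-linear space and let W be an ℝ-linear subspace of the ℂ-linear endomorphisms of V such that every nonzero h ∈ W has rank exactly 2. Then at least one of the following holds: (i) the ℂ-linear span of the union of the ranges of all h ∈ W has dimension at most 2; (ii) there is a nonzero f₀ ∈ V with h f₀ = 0 for all h ∈ W; (iii) there exists an injective ℝ-linear map f : W → V, unique up to multiplication by a nonzero complex scalar, such that h(f(h)) = 0 for all h ∈ W, and consequently h(f(h')) + h'(f(h)) = 0 for all h, h' ∈ W. -/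
section

open MvPolynomial Matrix

/-- Over a unique factorization domain, a matrix all of whose `2 × 2` minors vanish is the product
of a column vector and a row vector. -/
theorem exists_eq_vecMulVec_of_minors_eq {R m n : Type*} [CommRing R] [IsDomain R]
    [UniqueFactorizationMonoid R] [Fintype m] (A : Matrix m n R)
    (hA : ∀ i j k l, A i j * A k l = A i l * A k j) :
    ∃ (x : m → R) (y : n → R), A = vecMulVec x y := by
  classical
  by_cases hA0 : A = 0
  · exact ⟨0, 0, by simp [hA0]⟩
  obtain ⟨p, q, hpq⟩ : ∃ p q, A p q ≠ 0 := by
    by_contra! h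
    exact hA0 (Matrix.ext h)
  let _ : NormalizedGCDMonoid R := Classical.arbitrary _
  obtain ⟨x, hx, hx1⟩ := Finset.extract_gcd (s := Finset.univ) (fun i => A i q) ⟨p, by simp⟩
  set g := Finset.univ.gcd fun i => A i q with hg
  simp only [Finset.mem_univ, true_imp_iff] at hx
  have hg0 : g ≠ 0 := fun h => hpq (by simp [hx, h])
  have hxp : x p ≠ 0 := fun h => hpq (by simp [hx, h])
  have hcol : ∀ i j, A i j * x p = A p j * x i := fun i j => by
    have := hA i j p q
    rw [hx p, hx i] at this
    exact mul_left_cancel₀ hg0 (by linear_combination this)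
  have hdvd : ∀ j, x p ∣ A p j := fun j => by
    have h1 : x p ∣ Finset.univ.gcd fun i => A p j * x i :=
      Finset.dvd_gcd fun i _ => ⟨A i j, by rw [← hcol]; ring⟩
    have h2 := (Finset.gcd_mul_left' (s := Finset.univ) (f := x) (A p j)).dvd
    rw [hx1, mul_one] at h2
    exact h1.trans h2
  choose y hy using hdvd
  refine ⟨x, y, Matrix.ext fun i j => mul_right_cancel₀ hxp ?_⟩
  rw [hcol, hy, vecMulVec_apply]
  ring

/-- With cyclic indices, the entries of the adjugate of a `3 × 3` matrix carry no signs. -/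
theorem adjugate_fin_three_apply {R : Type*} [CommRing R] (A : Matrix (Fin 3) (Fin 3) R)
    (i j : Fin 3) : A.adjugate i j =
      A (j + 1) (i + 1) * A (j + 2) (i + 2) - A (j + 1) (i + 2) * A (j + 2) (i + 1) := by
  rw [adjugate_fin_three]
  fin_cases i <;> fin_cases j <;> simp [Fin.add_def] <;> ring

theorem adjugate_minors_eq_of_det_eq_zero {R : Type*} [CommRing R] (A : Matrix (Fin 3) (Fin 3) R)
    (hA : A.det = 0) (i j k l : Fin 3) :
    A.adjugate i j * A.adjugate k l = A.adjugate i l * A.adjugate k j := by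
  rw [det_fin_three] at hA
  rw [adjugate_fin_three]
  fin_cases i <;> fin_cases j <;> fin_cases k <;> fin_cases l <;> simp <;> grind

theorem minors_eq_of_adjugate_eq_zero {R : Type*} [CommRing R] (A : Matrix (Fin 3) (Fin 3) R)
    (hA : A.adjugate = 0) (i j k l : Fin 3) : A i j * A k l = A i l * A k j := by
  have h : ∀ i j, A (j + 1) (i + 1) * A (j + 2) (i + 2) -
      A (j + 1) (i + 2) * A (j + 2) (i + 1) = 0 := fun i j => by
    rw [← adjugate_fin_three_apply, hA, Matrix.zero_apply]
  have hind : ∀ i k : Fin 3, i = k ∨ ∃ p, i = p + 1 ∧ k = p + 2 ∨ i = p + 2 ∧ k = p + 1 := by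
    decide
  rcases hind i k with rfl | ⟨p, ⟨rfl, rfl⟩ | ⟨rfl, rfl⟩⟩
  · ring
  all_goals
    rcases hind j l with rfl | ⟨q, ⟨rfl, rfl⟩ | ⟨rfl, rfl⟩⟩
    · ring
    · grind
    · grind

theorem rank_le_one_of_adjugate_eq_zero {K : Type*} [Field K] (A : Matrix (Fin 3) (Fin 3) K)
    (hA : A.adjugate = 0) : A.rank ≤ 1 := by
  obtain ⟨x, y, rfl⟩ := exists_eq_vecMulVec_of_minors_eq A (minors_eq_of_adjugate_eq_zero A hA)
  exact rank_vecMulVec_le x y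

theorem exists_eq_C_add_sum_of_totalDegree_le_one {R σ : Type*} [CommRing R] [Fintype σ]
    (p : MvPolynomial σ R) (hp : p.totalDegree ≤ 1) :
    ∃ (a : R) (c : σ → R), p = C a + ∑ k, c k • X k := by
  have h1 := homogeneousComponent_mem 1 p
  rw [homogeneousSubmodule_one_eq_span_X, Submodule.mem_span_range_iff_exists_fun] at h1
  obtain ⟨c, hc⟩ := h1
  refine ⟨coeff 0 p, c, ?_⟩
  rw [hc, ← homogeneousComponent_zero]
  conv_lhs => rw [← sum_homogeneousComponent p]
  have h : ∑ i ∈ Finset.range 2, homogeneousComponent i p =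
      ∑ i ∈ Finset.range (p.totalDegree + 1), homogeneousComponent i p :=
    (Finset.sum_subset (by simpa using hp) fun i _ hi =>
      homogeneousComponent_eq_zero i p (by simpa using hi)).symm
  simpa [Finset.sum_range_succ] using h.symm

/-- A generically rank two `3 × 3` matrix of linear forms with zero determinant has a constant left
kernel vector, a constant kernel vector, or a linearly varying kernel vector. -/
theorem linear_kernel_of_singular {K σ : Type*} [Field K] [CharZero K] [Fintype σ]
    (M : Matrix (Fin 3) (Fin 3) (MvPolynomial σ K)) (hM : ∀ i j, (M i j).IsHomogeneous 1)
    (hdet : M.det = 0) (hadj : M.adjugate ≠ 0) :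
    (∃ b : Fin 3 → K, b ≠ 0 ∧ ∀ r : σ → K, b ᵥ* M.map (eval r) = 0) ∨
    (∃ a : Fin 3 → K, a ≠ 0 ∧ ∀ r : σ → K, M.map (eval r) *ᵥ a = 0) ∨
    ∃ c : σ → Fin 3 → K, (∀ r : σ → K, M.map (eval r) *ᵥ (∑ k, r k • c k) = 0) ∧
      ∀ r : σ → K, (M.map (eval r)).adjugate ≠ 0 → ∑ k, r k • c k ≠ 0 := by
  obtain ⟨x, y, hxy⟩ := exists_eq_vecMulVec_of_minors_eq _
    (adjugate_minors_eq_of_det_eq_zero M hdet)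
  have hx : x ≠ 0 := by rintro rfl; simp [hxy] at hadj
  have hy : y ≠ 0 := by rintro rfl; simp [hxy] at hadj
  have hMx : M *ᵥ x = 0 := by
    have h := M.mul_adjugate
    rw [hdet, zero_smul, hxy, mul_vecMulVec, vecMulVec_eq_zero] at h
    exact h.resolve_right hy
  have hyM : y ᵥ* M = 0 := by
    have h := M.adjugate_mul
    rw [hdet, zero_smul, hxy, vecMulVec_mul, vecMulVec_eq_zero] at h
    exact h.resolve_left hx
  have hMxr : ∀ r : σ → K, M.map (eval r) *ᵥ (fun i => eval r (x i)) = 0 := fun r => by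
    ext i
    simpa [mulVec, dotProduct] using congrArg (eval r) (congrFun hMx i)
  have hyMr : ∀ r : σ → K, (fun i => eval r (y i)) ᵥ* M.map (eval r) = 0 := fun r => by
    ext i
    simpa [vecMul, dotProduct] using congrArg (eval r) (congrFun hyM i)
  have hdeg : ∀ i j, (x i * y j).totalDegree ≤ 2 := fun i j => by
    have h : (M.adjugate i j).IsHomogeneous 2 := by
      rw [adjugate_fin_three_apply]
      exact ((hM _ _).mul (hM _ _)).sub ((hM _ _).mul (hM _ _))
    rw [hxy, vecMulVec_apply] at h
    exact h.totalDegree_le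
  by_cases hy0 : ∀ j, (y j).totalDegree = 0
  · left
    choose b hb using fun j => (⟨_, totalDegree_eq_zero_iff_eq_C.mp (hy0 j)⟩ : ∃ b, y j = C b)
    refine ⟨b, ?_, fun r => by simpa [hb] using hyMr r⟩
    rintro rfl
    exact hy (funext fun j => by simp [hb])
  right
  push Not at hy0
  obtain ⟨j, hj⟩ := hy0
  have hyj : y j ≠ 0 := by rintro h; simp [h] at hj
  have hxdeg : ∀ i, (x i).totalDegree ≤ 1 := fun i => by
    by_cases hxi : x i = 0
    · simp [hxi]
    have := hdeg i j
    rw [totalDegree_mul_of_isDomain hxi hyj] at this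
    lia
  choose a c hac using fun i => exists_eq_C_add_sum_of_totalDegree_le_one (x i) (hxdeg i)
  have hxr : ∀ r : σ → K, (fun i => eval r (x i)) = a + ∑ k, r k • fun i => c i k := fun r => by
    ext i
    simp [hac, smul_eval, mul_comm]
  have hneg : ∀ r : σ → K, M.map (eval (-r)) = -M.map (eval r) := fun r => by
    ext i j
    have h := hM i j
    rw [← mem_homogeneousSubmodule, homogeneousSubmodule_one_eq_span_X,
      Submodule.mem_span_range_iff_exists_fun] at h
    obtain ⟨c, hc⟩ := h
    simp [← hc, smul_eval]
  have hMa : ∀ r : σ → K, M.map (eval r) *ᵥ a = 0 ∧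
      M.map (eval r) *ᵥ (∑ k, r k • fun i => c i k) = 0 := fun r => by
    have h1 := hMxr r
    have h2 := hMxr (-r)
    rw [hxr, mulVec_add] at h1 h2
    simp only [hneg, neg_mulVec, Pi.neg_apply, neg_smul, Finset.sum_neg_distrib, mulVec_neg,
      neg_neg] at h2
    rw [neg_add_eq_zero] at h2
    rw [← h2, ← two_smul K, smul_eq_zero_iff_right two_ne_zero] at h1
    exact ⟨h1, h2 ▸ h1⟩
  by_cases ha : a = 0
  · right
    refine ⟨fun k i => c i k, fun r => (hMa r).2, fun r hr h0 => hr ?_⟩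
    have h1 := hxr r
    rw [ha, h0, add_zero] at h1
    have h2 : (M.map (eval r)).adjugate = M.adjugate.map (eval r) :=
      ((eval r).map_adjugate M).symm
    rw [h2, hxy]
    ext i j
    have := congrFun h1 i
    simp at this
    simp [vecMulVec_apply, this]
  · exact .inl ⟨a, ha, fun r => (hMa r).1⟩

/-- Two injective real-linear selections of kernel vectors agree up to a complex scalar. -/
theorem exists_smul_of_kernel_selection {V : Type*} [AddCommGroup V] [Module ℂ V]
    [Module ℝ V] [SMulCommClass ℂ ℝ V]
    {W : Submodule ℝ (V →ₗ[ℂ] V)} (hdim : Module.finrank ℂ V = 3)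
    (hrank : ∀ h ∈ W, h ≠ 0 → Module.finrank ℂ (LinearMap.range h) = 2)
    (hker : ¬ ∃ f₀ : V, f₀ ≠ 0 ∧ ∀ h ∈ W, h f₀ = 0) {f f' : W →ₗ[ℝ] V}
    (hf : Function.Injective f) (hfW : ∀ h : W, (h : V →ₗ[ℂ] V) (f h) = 0) (hf' : f' ≠ 0)
    (hfW' : ∀ h : W, (h : V →ₗ[ℂ] V) (f' h) = 0) :
    ∃ c : ℂ, c ≠ 0 ∧ ∀ h : W, f' h = c • f h := by
  have : FiniteDimensional ℂ V := FiniteDimensional.of_finrank_pos (by lia)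
  have hf0 : ∀ h : W, h ≠ 0 → f h ≠ 0 := fun h hh => (map_ne_zero_iff f hf).mpr hh
  have hline : ∀ h : W, h ≠ 0 → ∀ v, (h : V →ₗ[ℂ] V) v = 0 → ∃ c : ℂ, v = c • f h := by
    intro h hh v hv
    have h1 := LinearMap.finrank_range_add_finrank_ker (h : V →ₗ[ℂ] V)
    rw [hrank h h.2 (by simpa using hh), hdim] at h1
    obtain ⟨c, hc⟩ := exists_smul_eq_of_finrank_eq_one (show Module.finrank ℂ _ = 1 by lia)
      (x := (⟨f h, hfW h⟩ : LinearMap.ker (h : V →ₗ[ℂ] V))) 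
      (fun h0 => hf0 h hh (congrArg Subtype.val h0)) ⟨v, hv⟩
    exact ⟨c, (congrArg Subtype.val hc).symm⟩
  choose! c hc using fun (h : W) (hh : h ≠ 0) => hline h hh _ (hfW' h)
  have hindep : ∀ h h' : W, h ≠ 0 → (∀ a : ℂ, f h' ≠ a • f h) → c h = c h' := by
    intro h h' hh hhh'
    have hh0 : h' ≠ 0 := by rintro rfl; simpa using hhh' 0
    have hs : h + h' ≠ 0 := fun hs => hhh' (-1) (by
      rw [← neg_eq_of_add_eq_zero_right hs]; simp)
    have h1 := hc _ hs
    rw [map_add, map_add, hc h hh, hc h' hh0] at h1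
    have h2 : (c h - c (h + h')) • f h = (c (h + h') - c h') • f h' := by
      rw [sub_smul, sub_smul, sub_eq_sub_iff_add_eq_add, h1, smul_add, add_comm]
    by_cases h3 : c (h + h') - c h' = 0
    · rw [h3, zero_smul, smul_eq_zero_iff_left (hf0 h hh)] at h2
      linear_combination h2 + h3
    · refine (hhh' ((c (h + h') - c h')⁻¹ * (c h - c (h + h'))) ?_).elim
      rw [mul_smul, h2, inv_smul_smul₀ h3]
  obtain ⟨h₀, hh₀⟩ : ∃ h, f' h ≠ 0 := by
    by_contra! h
    exact hf' (LinearMap.ext h)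
  have h₀0 : h₀ ≠ 0 := by rintro rfl; simp at hh₀
  obtain ⟨h₁, hh₁⟩ : ∃ h₁, ∀ a : ℂ, f h₁ ≠ a • f h₀ := by
    by_contra! hall
    refine hker ⟨f h₀, hf0 _ h₀0, fun h hh => ?_⟩
    by_cases hz : (⟨h, hh⟩ : W) = 0
    · rw [show h = 0 from congrArg Subtype.val hz, LinearMap.zero_apply]
    obtain ⟨a, ha⟩ := hall ⟨h, hh⟩
    have ha0 : a ≠ 0 := by rintro rfl; exact hf0 _ hz (by simpa using ha)
    have := hfW ⟨h, hh⟩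
    rwa [ha, map_smul, smul_eq_zero_iff_right ha0] at this
  refine ⟨c h₀, fun h => hh₀ (by rw [hc _ h₀0, h, zero_smul]), fun h => ?_⟩
  by_cases hz : h = 0
  · simp [hz]
  rw [hc h hz]
  congr 1
  by_cases hd : ∀ a : ℂ, f h ≠ a • f h₀
  · exact (hindep _ _ h₀0 hd).symm
  push Not at hd
  obtain ⟨a, ha⟩ := hd
  rw [hindep h₀ h₁ h₀0 hh₁]
  refine hindep h h₁ hz fun b hb => hh₁ (b * a) ?_
  rw [hb, ha, mul_smul]

/-- Either the ranges of all members of `W` are contained in a hyperplane, or there is an injective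
real-linear selection of kernel vectors. -/
theorem linear_kernel_or_range_le {V : Type*} [AddCommGroup V] [Module ℂ V]
    [Module ℝ V] [IsScalarTower ℝ ℂ V] [SMulCommClass ℂ ℝ V]
    {W : Submodule ℝ (V →ₗ[ℂ] V)} (hdim : Module.finrank ℂ V = 3)
    (hrank : ∀ h ∈ W, h ≠ 0 → Module.finrank ℂ (LinearMap.range h) = 2)
    (hker : ¬ ∃ f₀ : V, f₀ ≠ 0 ∧ ∀ h ∈ W, h f₀ = 0) :
    (∃ φ : V →ₗ[ℂ] ℂ, φ ≠ 0 ∧ ∀ h ∈ W, φ ∘ₗ h = 0) ∨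
      ∃ f : W →ₗ[ℝ] V, Function.Injective f ∧ ∀ h : W, (h : V →ₗ[ℂ] V) (f h) = 0 := by
  have : FiniteDimensional ℂ V := FiniteDimensional.of_finrank_pos (by lia)
  have : FiniteDimensional ℝ (V →ₗ[ℂ] V) := Module.Finite.trans ℂ _
  let b : Module.Basis (Fin 3) ℂ V := Module.finBasisOfFinrankEq ℂ V hdim
  let w := Module.finBasis ℝ W
  let T : (V →ₗ[ℂ] V) → Matrix (Fin 3) (Fin 3) ℂ := LinearMap.toMatrix b b
  let M : Matrix (Fin 3) (Fin 3) (MvPolynomial (Fin (Module.finrank ℝ W)) ℂ) :=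
    of fun i j => ∑ k, C (T (w k) i j) * X k
  let r : W → Fin (Module.finrank ℝ W) → ℂ := fun h k => (w.repr h k : ℂ)
  have hMr : ∀ h : W, M.map (eval (r h)) = T h := fun h => by
    have h1 : (h : V →ₗ[ℂ] V) = ∑ k, (w.repr h k : ℂ) • (w k : V →ₗ[ℂ] V) := by
      have h2 := congrArg Subtype.val (w.sum_repr h)
      rw [AddSubmonoidClass.coe_finsetSum] at h2
      rw [← h2]
      exact Finset.sum_congr rfl fun k _ => (algebraMap_smul ℂ _ _).symm
    have h3 : T h = ∑ k, r h k • T (w k) := by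
      simp only [T, r]
      conv_lhs => rw [h1, map_sum]
      exact Finset.sum_congr rfl fun k _ => map_smul _ _ _
    ext i j
    simp [h3, M, Matrix.sum_apply, mul_comm]
  have hTmul : ∀ (h : V →ₗ[ℂ] V) (u : Fin 3 → ℂ),
      h (b.equivFun.symm u) = b.equivFun.symm (T h *ᵥ u) := fun h u => by
    rw [LinearEquiv.eq_symm_apply]
    have := LinearMap.toMatrix_mulVec_repr b b h (b.equivFun.symm u)
    rw [← b.equivFun_apply, b.equivFun.apply_symm_apply] at this
    exact this.symm
  have hTrank : ∀ h : W, h ≠ 0 → (T h).rank = 2 := fun h hh => by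
    rw [rank_eq_finrank_range_toLin _ b b, toLin_toMatrix, hrank h h.2 (by simpa using hh)]
  have hTadj : ∀ h : W, h ≠ 0 → (T h).adjugate ≠ 0 := fun h hh h0 => by
    have := rank_le_one_of_adjugate_eq_zero _ h0
    rw [hTrank h hh] at this
    lia
  have hTdet : ∀ h : W, (T h).det = 0 := fun h => by
    by_contra hd
    by_cases hh : h = 0
    · simp [hh, T] at hd
    have h1 := rank_of_isUnit (T h) ((isUnit_iff_isUnit_det _).mpr (Ne.isUnit hd))
    rw [hTrank h hh] at h1
    simp at h1
  by_cases hW : ∀ h : W, h = 0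
  · refine .inl ⟨b.coord 0, fun h0 => ?_, fun h hh => ?_⟩
    · simpa using LinearMap.congr_fun h0 (b 0)
    · rw [show h = 0 from congrArg Subtype.val (hW ⟨h, hh⟩), LinearMap.comp_zero]
  push Not at hW
  obtain ⟨h₁, hh₁⟩ := hW
  have hadj : ∀ h : W, M.adjugate.map (eval (r h)) = (T h).adjugate := fun h => by
    rw [← hMr]
    exact (eval (r h)).map_adjugate M
  have hM : ∀ i j, (M i j).IsHomogeneous 1 := fun i j =>
    IsHomogeneous.sum Finset.univ (fun k => C (T (w k) i j) * X k) 1 fun k _ =>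
      isHomogeneous_C_mul_X (T (w k) i j) k
  have hMdet : M.det = 0 := by
    refine funext_set (fun _ => Set.range ((↑) : ℝ → ℂ))
      (fun _ => Set.infinite_range_of_injective Complex.ofReal_injective) fun x hx => ?_
    choose s hs using fun k => hx k (Set.mem_univ k)
    have hrx : r (w.equivFun.symm s) = x := by
      ext k
      rw [← hs]
      exact congrArg Complex.ofReal (congrFun (w.equivFun.apply_symm_apply s) k)
    rw [← hrx, map_zero, RingHom.map_det]
    exact (congrArg det (hMr _)).trans (hTdet _)
  have hMadj : M.adjugate ≠ 0 := fun h0 => hTadj h₁ hh₁ (by rw [← hadj, h0]; ext; simp)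
  rcases linear_kernel_of_singular M hM hMdet hMadj with ⟨y, hy, hyM⟩ | ⟨a, ha, haM⟩ | ⟨c, hc, hc0⟩
  · left
    refine ⟨∑ i, y i • b.coord i, fun h0 => hy ?_, fun h hh => b.ext fun j => ?_⟩
    · ext i
      simpa [Finsupp.single_apply] using LinearMap.congr_fun h0 (b i)
    · have h1 := congrFun (hyM (r ⟨h, hh⟩)) j
      rw [hMr] at h1
      simpa [T, vecMul, dotProduct, LinearMap.toMatrix_apply] using h1
  · refine (hker ⟨b.equivFun.symm a, b.equivFun.symm.map_ne_zero_iff.mpr ha, fun h hh => ?_⟩).elim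
    have h1 := haM (r ⟨h, hh⟩)
    rw [hMr] at h1
    rw [hTmul, h1, map_zero]
  · right
    let f : W →ₗ[ℝ] V := w.constr ℝ fun k => b.equivFun.symm (c k)
    have hf : ∀ h, f h = b.equivFun.symm (∑ k, r h k • c k) := fun h => by
      rw [w.constr_apply_fintype ℝ, map_sum]
      refine Finset.sum_congr rfl fun k _ => ?_
      rw [map_smul, w.equivFun_apply]
      exact (algebraMap_smul ℂ _ _).symm
    refine ⟨f, (injective_iff_map_eq_zero f).mpr fun h hh => ?_, fun h => ?_⟩
    · by_contra h0
      rw [hf, LinearEquiv.map_eq_zero_iff] at hh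
      exact hc0 (r h) (by rw [hMr]; exact hTadj h h0) hh
    · rw [hf, hTmul, ← hMr, hc, map_zero]

end

/-- Lemma 3.3. -/
theorem stmt_18 (V : Type*) [AddCommGroup V] [Module ℂ V] [Module ℝ V]
    [IsScalarTower ℝ ℂ V] [SMulCommClass ℂ ℝ V]
    (hdim : Module.finrank ℂ V = 3)
    (W : Submodule ℝ (V →ₗ[ℂ] V))
    (hrank : ∀ h ∈ W, h ≠ 0 → Module.finrank ℂ (LinearMap.range h) = 2) :
    Module.finrank ℂ
        (Submodule.span ℂ (⋃ h ∈ (W : Set (V →ₗ[ℂ] V)), (LinearMap.range h : Set V))) ≤ 2 ∨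
      (∃ f₀ : V, f₀ ≠ 0 ∧ ∀ h ∈ W, h f₀ = 0) ∨
      (∃ f : W →ₗ[ℝ] V, Function.Injective f ∧
        (∀ h : W, (h : V →ₗ[ℂ] V) (f h) = 0) ∧
        (∀ f' : W →ₗ[ℝ] V, f' ≠ 0 → (∀ h : W, (h : V →ₗ[ℂ] V) (f' h) = 0) →
          ∃ c : ℂ, c ≠ 0 ∧ ∀ h : W, f' h = c • f h) ∧
        (∀ h h' : W, (h : V →ₗ[ℂ] V) (f h') + (h' : V →ₗ[ℂ] V) (f h) = 0)) := by
  have : FiniteDimensional ℂ V := FiniteDimensional.of_finrank_pos (by lia)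
  by_cases hker : ∃ f₀ : V, f₀ ≠ 0 ∧ ∀ h ∈ W, h f₀ = 0
  · exact .inr (.inl hker)
  rcases linear_kernel_or_range_le hdim hrank hker with ⟨φ, hφ, hφW⟩ | ⟨f, hf, hfW⟩
  · left
    have hle : Submodule.span ℂ (⋃ h ∈ (W : Set (V →ₗ[ℂ] V)), (LinearMap.range h : Set V)) ≤
        LinearMap.ker φ := by
      rw [Submodule.span_le]
      simp only [Set.iUnion_subset_iff]
      rintro h hh _ ⟨v, rfl⟩
      exact LinearMap.congr_fun (hφW h hh) v
    have hlt := Submodule.finrank_lt (s := LinearMap.ker φ) (by rwa [Ne, LinearMap.ker_eq_top])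
    have := Submodule.finrank_mono hle
    lia
  · exact .inr (.inr ⟨f, hf, hfW, fun f' hf' hfW' =>
      exists_smul_of_kernel_selection hdim hrank hker hf hfW hf' hfW',
      fun h h' => by simpa [hfW] using hfW (h + h')⟩)
end
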